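/- Let J : ℝⁿ → [0,∞] satisfy (T J)(x) ≤ J(x) for all x (i.e., J belongs to the region of decreasing), let ℓ be a positive integer, and let μ̃ be a policy satisfying (T_{μ̃}(T^{ℓ−1} J))(x) = (T^ℓ J)(x) for all x ∈ ℝⁿ. Then for every x ∈ ℝⁿ and every policy μ, J_{μ̃}(x) ≤ (T^ℓ J)(x) ≤ (T_μ^ℓ J)(x). -/

import Mathlib

open Matrix ENNReal

/-- The stage cost g(x,u) = xᵀQx + uᵀRu if x ∈ X̂, and g(x,u) = ∞ otherwise,
valued in the extended nonnegative reals. -/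
noncomputable def stageCost {n m : ℕ} (Q : Matrix (Fin n) (Fin n) ℝ)
    (R : Matrix (Fin m) (Fin m) ℝ) (Xhat : Set (Fin n → ℝ))
    (x : Fin n → ℝ) (u : Fin m → ℝ) : ℝ≥0∞ := by
  classical exact
    if x ∈ Xhat then ENNReal.ofReal (x ⬝ᵥ Q.mulVec x + u ⬝ᵥ R.mulVec u) else ⊤

/-- The closed-loop trajectory x_{k+1} = A x_k + B μ(x_k) starting from x₀. -/
noncomputable def traj {n m : ℕ} (A : Matrix (Fin n) (Fin n) ℝ)
    (B : Matrix (Fin n) (Fin m) ℝ) (μ : (Fin n → ℝ) → (Fin m → ℝ))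
    (x0 : Fin n → ℝ) : ℕ → (Fin n → ℝ)
  | 0 => x0
  | k + 1 => A.mulVec (traj A B μ x0 k) + B.mulVec (μ (traj A B μ x0 k))

/-- The cost J_μ(x₀) = Σ_{k=0}^∞ g(x_k, μ(x_k)) of a stationary policy μ. -/
noncomputable def polCost {n m : ℕ} (A : Matrix (Fin n) (Fin n) ℝ)
    (B : Matrix (Fin n) (Fin m) ℝ) (Q : Matrix (Fin n) (Fin n) ℝ)
    (R : Matrix (Fin m) (Fin m) ℝ) (Xhat : Set (Fin n → ℝ))
    (μ : (Fin n → ℝ) → (Fin m → ℝ)) (x0 : Fin n → ℝ) : ℝ≥0∞ :=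
  ∑' k : ℕ, stageCost Q R Xhat (traj A B μ x0 k) (μ (traj A B μ x0 k))

/-- The Bellman operator (T J)(x) = inf_{u ∈ U} { g(x,u) + J(Ax + Bu) }. -/
noncomputable def Tbell {n m : ℕ} (A : Matrix (Fin n) (Fin n) ℝ)
    (B : Matrix (Fin n) (Fin m) ℝ) (Q : Matrix (Fin n) (Fin n) ℝ)
    (R : Matrix (Fin m) (Fin m) ℝ) (Xhat : Set (Fin n → ℝ)) (U : Set (Fin m → ℝ))
    (J : (Fin n → ℝ) → ℝ≥0∞) (x : Fin n → ℝ) : ℝ≥0∞ :=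
  ⨅ u ∈ U, stageCost Q R Xhat x u + J (A.mulVec x + B.mulVec u)

/-- The policy operator (T_μ J)(x) = g(x, μ(x)) + J(Ax + B μ(x)). -/
noncomputable def Tmu {n m : ℕ} (A : Matrix (Fin n) (Fin n) ℝ)
    (B : Matrix (Fin n) (Fin m) ℝ) (Q : Matrix (Fin n) (Fin n) ℝ)
    (R : Matrix (Fin m) (Fin m) ℝ) (Xhat : Set (Fin n → ℝ))
    (μ : (Fin n → ℝ) → (Fin m → ℝ)) (J : (Fin n → ℝ) → ℝ≥0∞)
    (x : Fin n → ℝ) : ℝ≥0∞ :=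
  stageCost Q R Xhat x (μ x) + J (A.mulVec x + B.mulVec (μ x))

theorem Tbell_mono {n m : ℕ} (A : Matrix (Fin n) (Fin n) ℝ) (B : Matrix (Fin n) (Fin m) ℝ)
    (Q : Matrix (Fin n) (Fin n) ℝ) (R : Matrix (Fin m) (Fin m) ℝ)
    (Xhat : Set (Fin n → ℝ)) (U : Set (Fin m → ℝ)) :
    Monotone (Tbell A B Q R Xhat U) := fun _ _ h _ =>
  iInf₂_mono fun _ _ => add_le_add_right (h _) _

theorem Tmu_mono {n m : ℕ} (A : Matrix (Fin n) (Fin n) ℝ) (B : Matrix (Fin n) (Fin m) ℝ)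
    (Q : Matrix (Fin n) (Fin n) ℝ) (R : Matrix (Fin m) (Fin m) ℝ)
    (Xhat : Set (Fin n → ℝ)) (μ : (Fin n → ℝ) → (Fin m → ℝ)) :
    Monotone (Tmu A B Q R Xhat μ) := fun _ _ h _ =>
  add_le_add_right (h _) _

theorem Tbell_le_Tmu {n m : ℕ} (A : Matrix (Fin n) (Fin n) ℝ) (B : Matrix (Fin n) (Fin m) ℝ)
    (Q : Matrix (Fin n) (Fin n) ℝ) (R : Matrix (Fin m) (Fin m) ℝ)
    (Xhat : Set (Fin n → ℝ)) (U : Set (Fin m → ℝ)) (μ : (Fin n → ℝ) → (Fin m → ℝ))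
    (hμ : ∀ y, μ y ∈ U) : Tbell A B Q R Xhat U ≤ Tmu A B Q R Xhat μ :=
  fun _ x => iInf₂_le (μ x) (hμ x)

/-- A function that does not increase under `Tmu` for `μ` bounds the cost of `μ`. -/
theorem polCost_le_of_Tmu_le {n m : ℕ} (A : Matrix (Fin n) (Fin n) ℝ)
    (B : Matrix (Fin n) (Fin m) ℝ) (Q : Matrix (Fin n) (Fin n) ℝ)
    (R : Matrix (Fin m) (Fin m) ℝ) (Xhat : Set (Fin n → ℝ))
    (μ : (Fin n → ℝ) → (Fin m → ℝ)) (V : (Fin n → ℝ) → ℝ≥0∞)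
    (hV : Tmu A B Q R Xhat μ V ≤ V) (x : Fin n → ℝ) :
    polCost A B Q R Xhat μ x ≤ V x := by
  have key : ∀ N, ∑ k ∈ Finset.range N,
      stageCost Q R Xhat (traj A B μ x k) (μ (traj A B μ x k)) + V (traj A B μ x N) ≤ V x := by
    intro N
    induction N with
    | zero => simp [traj]
    | succ N ih =>
      rw [Finset.sum_range_succ, add_assoc]
      exact (add_le_add_right (hV (traj A B μ x N)) _).trans ih
  exact ENNReal.tsum_le_of_sum_range_le fun N => le_self_add.trans (key N)

/-- performance bound for the MPC policy μ̃ defined by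
T_{μ̃}(T^{ℓ−1}J) = T^ℓ J when J is in the region of decreasing:
J_{μ̃} ≤ T^ℓ J ≤ T_μ^ℓ J for every policy μ. -/
theorem mpc_policy_performance_bound {n m : ℕ} (hn : 0 < n) (hm : 0 < m)
    (A : Matrix (Fin n) (Fin n) ℝ) (B : Matrix (Fin n) (Fin m) ℝ)
    (Q : Matrix (Fin n) (Fin n) ℝ) (R : Matrix (Fin m) (Fin m) ℝ)
    (hQ : Q.PosSemidef) (hR : R.PosDef)
    (Xhat : Set (Fin n → ℝ)) (U : Set (Fin m → ℝ)) (hU : U.Nonempty)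
    (J : (Fin n → ℝ) → ℝ≥0∞)
    (hJ : ∀ x, Tbell A B Q R Xhat U J x ≤ J x)
    (ℓ : ℕ) (hℓ : 1 ≤ ℓ)
    (μtil : (Fin n → ℝ) → (Fin m → ℝ)) (hμtil : ∀ x, μtil x ∈ U)
    (hdef : ∀ x, Tmu A B Q R Xhat μtil ((Tbell A B Q R Xhat U)^[ℓ - 1] J) x =
      (Tbell A B Q R Xhat U)^[ℓ] J x) :
    ∀ x, ∀ μ : (Fin n → ℝ) → (Fin m → ℝ), (∀ y, μ y ∈ U) →
      polCost A B Q R Xhat μtil x ≤ (Tbell A B Q R Xhat U)^[ℓ] J x ∧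
      (Tbell A B Q R Xhat U)^[ℓ] J x ≤ (Tmu A B Q R Xhat μ)^[ℓ] J x := by
  intro x μ hμ
  have hanti := (Tbell_mono A B Q R Xhat U).antitone_iterate_of_map_le hJ
  refine ⟨polCost_le_of_Tmu_le A B Q R Xhat μtil _ (fun y => ?_) x, ?_⟩
  · rw [← hdef y]
    exact Tmu_mono A B Q R Xhat μtil (hanti (Nat.sub_le ℓ 1)) y
  · exact (Tbell_mono A B Q R Xhat U).iterate_le_of_le (Tbell_le_Tmu A B Q R Xhat U μ hμ) ℓ J x
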